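/- Define on [0,1] the function G(γ) = max{ H(γ) + (1-γ) + γ·log₂(1 + 1/σ²(γ)), γ·log₂(1 + σ²(γ)) } where σ²(γ) = 2^{(H(γ)+(1-γ))/γ} for γ ∈ (0,1] (and the first expression is interpreted by continuity at γ=0). Then G(γ) = γ·log₂(1+σ²(γ)) ≤ 1.6081 for all γ ∈ [0,1], with maximum attained near γ ≈ 0.3855. -/

import Mathlib

open Real

/-- Binary entropy in bits. -/
noncomputable def binH (γ : ℝ) : ℝ := -γ * Real.logb 2 γ - (1 - γ) * Real.logb 2 (1 - γ)

/-- Quantization noise equalizing the two NNC gap terms. -/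
noncomputable def sigmaSq (γ : ℝ) : ℝ := 2 ^ ((binH γ + (1 - γ)) / γ)

/-- The natural logarithm of `sigmaSq γ`, in the variable `u = (1 - γ) / γ`. -/
noncomputable def logNoise (u : ℝ) : ℝ :=
  (1 + u) * log (1 + u) + u * log 2 - u * log u

/-- The derivative of `logNoise`. -/
noncomputable def logNoiseSlope (u : ℝ) : ℝ := log 2 + log (1 + u) - log u

lemma hasDerivAt_logNoise {u : ℝ} (hu : 0 < u) :
    HasDerivAt logNoise (logNoiseSlope u) u := by
  have h1 : HasDerivAt (fun u : ℝ => 1 + u) 1 u := (hasDerivAt_id u).const_add 1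
  have hlog : HasDerivAt (fun u : ℝ => log (1 + u)) (1 / (1 + u)) u := h1.log (by positivity)
  have h := ((h1.mul hlog).add ((hasDerivAt_id u).mul_const (log 2))).sub
    ((hasDerivAt_id u).mul (hasDerivAt_log hu.ne'))
  refine h.congr_deriv ?_
  unfold logNoiseSlope
  simp only [id]
  field_simp
  ring

lemma hasDerivAt_logNoiseSlope {u : ℝ} (hu : 0 < u) :
    HasDerivAt logNoiseSlope (-(1 / (u * (1 + u)))) u := by
  have h1 : HasDerivAt (fun u : ℝ => 1 + u) 1 u := (hasDerivAt_id u).const_add 1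
  have hlog : HasDerivAt (fun u : ℝ => log (1 + u)) (1 / (1 + u)) u := h1.log (by positivity)
  have h := (hlog.const_add (log 2)).sub (hasDerivAt_log hu.ne')
  refine h.congr_deriv ?_
  field_simp
  ring

lemma hasDerivAt_log_one_add_exp_logNoise {u : ℝ} (hu : 0 < u) :
    HasDerivAt (fun u => log (1 + exp (logNoise u)))
      (logNoiseSlope u * (exp (logNoise u) / (1 + exp (logNoise u)))) u := by
  have h := ((hasDerivAt_logNoise hu).exp.const_add 1).log (by positivity)
  exact h.congr_deriv (by ring)

lemma hasDerivAt_deriv_log_one_add_exp_logNoise {u : ℝ} (hu : 0 < u) :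
    HasDerivAt (fun u => logNoiseSlope u * (exp (logNoise u) / (1 + exp (logNoise u))))
      (exp (logNoise u) / (1 + exp (logNoise u)) *
        (logNoiseSlope u ^ 2 / (1 + exp (logNoise u)) - 1 / (u * (1 + u)))) u := by
  have he := (hasDerivAt_logNoise hu).exp
  have hpos : 1 + exp (logNoise u) ≠ 0 := by positivity
  have h := (hasDerivAt_logNoiseSlope hu).mul (he.div (he.const_add 1) hpos)
  refine h.congr_deriv ?_
  simp only [Pi.div_apply]
  field_simp
  ring

lemma log_sq_le {x : ℝ} (hx : 1 ≤ x) : log x ^ 2 ≤ (x - 1) ^ 2 / x := by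
  have hx0 : 0 < x := by linarith
  have hlog : 0 ≤ log x := log_nonneg hx
  have h : log x / 2 ≤ sinh (log x / 2) := self_le_sinh_iff.2 (by positivity)
  have hsq : 4 * sinh (log x / 2) ^ 2 = (x - 1) ^ 2 / x := by
    have h2 := cosh_two_mul (log x / 2)
    rw [mul_div_cancel₀ _ two_ne_zero, cosh_sq, cosh_log hx0] at h2
    field_simp at h2 ⊢
    linarith
  rw [← hsq]
  nlinarith

lemma mul_logNoiseSlope_sq_le {u : ℝ} (hu : 0 < u) :
    u * (1 + u) * logNoiseSlope u ^ 2 ≤ 1 + exp (logNoise u) := by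
  obtain ⟨r, hr⟩ : ∃ r, r = log ((1 + u) / u) := ⟨_, rfl⟩
  have hle : logNoiseSlope u = log 2 + r := by
    rw [hr, logNoiseSlope, log_div (by positivity) hu.ne']
    ring
  have hx : 1 ≤ (1 + u) / u := by rw [le_div_iff₀ hu]; linarith
  have hsq : u * (1 + u) * r ^ 2 ≤ 1 := by
    have h := log_sq_le hx
    rw [← hr] at h
    calc u * (1 + u) * r ^ 2
        ≤ u * (1 + u) * (((1 + u) / u - 1) ^ 2 / ((1 + u) / u)) := by gcongr
      _ = 1 := by field_simp; ring
  have hr1 : 1 ≤ (1 + u) * r := by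
    have h := one_sub_inv_le_log_of_pos (show 0 < (1 + u) / u by positivity)
    rw [← hr, inv_div] at h
    calc 1 = (1 + u) * (1 - u / (1 + u)) := by field_simp; ring
      _ ≤ (1 + u) * r := by gcongr
  have hexp : (1 + u) * (1 + u * (log 2 + r)) ≤ exp (logNoise u) := by
    have : logNoise u = log (1 + u) + u * (log 2 + r) := by
      rw [← hle, logNoise, logNoiseSlope]
      ring
    rw [this, exp_add, exp_log (by positivity)]
    gcongr
    linarith [add_one_le_exp (u * (log 2 + r))]
  have hl0 : 0 ≤ log 2 := log_nonneg one_le_two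
  have hl1 : log 2 ≤ 1 := by linarith [log_two_lt_d9]
  have hlsq : log 2 ^ 2 ≤ log 2 := by nlinarith
  have hamgm : 0 ≤ (1 + u) * (log 2 - u * r) ^ 2 := by positivity
  have hsq' : u * (u * (1 + u) * r ^ 2) ≤ u * ((1 + u) * r) :=
    mul_le_mul_of_nonneg_left (hsq.trans hr1) hu.le
  have hl2 : (1 + u) * (1 + u) * log 2 ^ 2 ≤ (1 + u) * (1 + u * log 2) := by
    rw [mul_assoc]
    gcongr
    nlinarith
  rw [hle]
  linarith

lemma concaveOn_log_one_add_exp_logNoise :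
    ConcaveOn ℝ (Set.Ioi 0) (fun u => log (1 + exp (logNoise u))) := by
  refine concaveOn_of_hasDerivWithinAt2_nonpos (convex_Ioi 0)
    (fun u hu => (hasDerivAt_log_one_add_exp_logNoise hu).continuousAt.continuousWithinAt)
    (fun u hu => (hasDerivAt_log_one_add_exp_logNoise
      (by simpa using hu)).hasDerivWithinAt)
    (fun u hu => (hasDerivAt_deriv_log_one_add_exp_logNoise
      (by simpa using hu)).hasDerivWithinAt) fun u hu => ?_
  have hu0 : 0 < u := by simpa using hu
  refine mul_nonpos_of_nonneg_of_nonpos (by positivity) (sub_nonpos.2 ?_)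
  rw [div_le_div_iff₀ (by positivity) (by positivity)]
  linarith [mul_logNoiseSlope_sq_le hu0]

lemma ConcaveOn.le_tangent {s : Set ℝ} {f : ℝ → ℝ} {f' x y : ℝ} (hf : ConcaveOn ℝ s f)
    (hx : x ∈ s) (hy : y ∈ s) (hf' : HasDerivAt f f' x) : f y ≤ f x + f' * (y - x) := by
  rcases lt_trichotomy x y with h | rfl | h
  · have := hf.slope_le_of_hasDerivAt hx hy h hf'
    rw [slope_def_field, div_le_iff₀ (sub_pos.2 h)] at this
    linarith
  · simp
  · have := hf.le_slope_of_hasDerivAt hy hx h hf'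
    rw [slope_def_field, le_div_iff₀ (sub_pos.2 h)] at this
    linarith

lemma log_seventeen_bounds : 2.833213 < log 17 ∧ log 17 < 2.833214 := by
  have h1 := sum_range_le_log_div (x := 1 / 33) (by norm_num) (by norm_num) 3
  have h2 := log_div_le_sum_range_add (x := 1 / 33) (by norm_num) (by norm_num) 3
  have h : log ((1 + 1 / 33) / (1 - 1 / 33)) = log 17 - 4 * log 2 := by
    rw [show (1 + 1 / 33 : ℝ) / (1 - 1 / 33) = 17 / 2 ^ 4 by norm_num,
      log_div (by norm_num) (by norm_num), log_pow]
    norm_num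
  rw [h] at h1 h2
  norm_num [Finset.sum_range_succ] at h1 h2
  constructor <;> linarith [log_two_gt_d9, log_two_lt_d9]

lemma log_eighty_three_bounds : 4.418840 < log 83 ∧ log 83 < 4.418841 := by
  have h1 := sum_range_le_log_div (x := 1 / 82) (by norm_num) (by norm_num) 3
  have h2 := log_div_le_sum_range_add (x := 1 / 82) (by norm_num) (by norm_num) 3
  have h : log ((1 + 1 / 82) / (1 - 1 / 82)) = log 83 - 4 * log 3 := by
    rw [show (1 + 1 / 82 : ℝ) / (1 - 1 / 82) = 83 / 3 ^ 4 by norm_num,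
      log_div (by norm_num) (by norm_num), log_pow]
    norm_num
  rw [h] at h1 h2
  norm_num [Finset.sum_range_succ] at h1 h2
  constructor <;> linarith [log_three_gt_d9, log_three_lt_d9]

lemma logNoiseSlope_at : logNoiseSlope (51 / 32) = log 2 + log 83 - log 3 - log 17 := by
  rw [logNoiseSlope, show (1 + 51 / 32 : ℝ) = 83 / 32 by norm_num,
    log_div (by norm_num) (by norm_num), log_div (by norm_num) (by norm_num),
    show (51 : ℝ) = 3 * 17 by norm_num, log_mul (by norm_num) (by norm_num)]
  ring

lemma logNoise_at :
    logNoise (51 / 32) = log 83 - 5 * log 2 + 51 / 32 * logNoiseSlope (51 / 32) := by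
  rw [logNoise, logNoiseSlope, show (1 + 51 / 32 : ℝ) = 83 / 2 ^ 5 by norm_num,
    log_div (by norm_num) (by norm_num), log_pow]
  push_cast
  ring

lemma exp_logNoise_at_bounds :
    17.0129 ≤ exp (logNoise (51 / 32)) ∧ exp (logNoise (51 / 32)) ≤ 17.0135 := by
  obtain ⟨h17, h17'⟩ := log_seventeen_bounds
  obtain ⟨h83, h83'⟩ := log_eighty_three_bounds
  have h2 := log_two_gt_d9
  have h2' := log_two_lt_d9
  have h3 := log_three_gt_d9
  have h3' := log_three_lt_d9
  constructor
  · rw [← log_le_iff_le_exp (by norm_num), logNoise_at, logNoiseSlope_at]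
    have h := log_le_sub_one_of_pos (show (0 : ℝ) < 17.0129 / 17 by norm_num)
    rw [log_div (by norm_num) (by norm_num)] at h
    linarith
  · rw [← le_log_iff_exp_le (by norm_num), logNoise_at, logNoiseSlope_at]
    have h := one_sub_inv_le_log_of_pos (show (0 : ℝ) < 17.0135 / 17 by norm_num)
    rw [log_div (by norm_num) (by norm_num)] at h
    norm_num at h ⊢
    linarith

/-- `51 / 32` is close to the maximizer of `log (1 + exp (logNoise u)) / (1 + u)`. -/
lemma log_one_add_exp_logNoise_le {u : ℝ} (hu : 0 < u) :
    log (1 + exp (logNoise u)) ≤ 1.6081 * log 2 * (1 + u) := by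
  have htan := concaveOn_log_one_add_exp_logNoise.le_tangent
    (x := 51 / 32) (y := u) (by norm_num) hu
    (hasDerivAt_log_one_add_exp_logNoise (by norm_num))
  obtain ⟨hE, hE'⟩ := exp_logNoise_at_bounds
  obtain ⟨h17, h17'⟩ := log_seventeen_bounds
  obtain ⟨h83, h83'⟩ := log_eighty_three_bounds
  have h2 := log_two_gt_d9
  have h2' := log_two_lt_d9
  have h3 := log_three_gt_d9
  have h3' := log_three_lt_d9
  have hslope := logNoiseSlope_at
  have hl0 : 0 < logNoiseSlope (51 / 32) := by linarith
  have hnoise := logNoise_at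
  set l := logNoiseSlope (51 / 32)
  set E := exp (logNoise (51 / 32)) with hEdef
  have hl1 : l ≤ 1.180163 := by linarith
  have hsig : E / (1 + E) ≤ 17.0135 / 18.0135 := by
    rw [div_le_div_iff₀ (by positivity) (by norm_num)]
    linarith
  have hinv : 1 / (1 + E) ≤ 1 / 18.0129 := by
    gcongr
    linarith
  have hderiv : l * (E / (1 + E)) ≤ 1.6081 * log 2 := by
    calc l * (E / (1 + E)) ≤ 1.180163 * (17.0135 / 18.0135) := by gcongr
      _ ≤ 1.6081 * log 2 := by linarith
  have hlogE : log (1 + E) = logNoise (51 / 32) + log (1 + 1 / E) := by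
    rw [← log_exp (logNoise (51 / 32)), ← hEdef, ← log_mul (by positivity) (by positivity)]
    congr 1
    field_simp
    ring
  have hlog : log (1 + 1 / E) ≤ log 2 + 2 * log 3 - log 17 +
      ((1 + 1 / 17.0129) * (17 / 18) - 1) := by
    have h := log_le_sub_one_of_pos (show 0 < (1 + 1 / E) * (17 / 18) by positivity)
    rw [log_mul (by positivity) (by norm_num), log_div (by norm_num) (by norm_num),
      show (18 : ℝ) = 2 * 3 ^ 2 by norm_num, log_mul (by norm_num) (by norm_num), log_pow] at h
    have : 1 / E ≤ 1 / 17.0129 := by gcongr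
    push_cast at h
    linarith
  have hconst : log (1 + E) - 51 / 32 * (l * (E / (1 + E))) ≤ 1.6081 * log 2 := by
    have hsplit : E / (1 + E) = 1 - 1 / (1 + E) := by
      field_simp
      ring
    have hprod : l * (1 / (1 + E)) ≤ 1.180163 * (1 / 18.0129) := by gcongr
    rw [hsplit, hlogE, hnoise]
    linarith
  nlinarith [mul_le_mul_of_nonneg_right hderiv hu.le]

lemma binH_eq (γ : ℝ) : binH γ = binEntropy γ / log 2 := by
  rw [binH, binEntropy_eq_negMulLog_add_negMulLog_one_sub, negMulLog, negMulLog, logb, logb]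
  ring

lemma sigmaSq_eq_exp_logNoise {γ : ℝ} (h0 : 0 < γ) (h1 : γ < 1) :
    sigmaSq γ = exp (logNoise ((1 - γ) / γ)) := by
  have h1' : 0 < 1 - γ := by linarith
  rw [sigmaSq, rpow_def_of_pos two_pos, logNoise, binH, logb, logb,
    show 1 + (1 - γ) / γ = 1 / γ by field_simp; ring, log_div h1'.ne' h0.ne',
    log_div one_ne_zero h0.ne', log_one]
  have : log 2 ≠ 0 := by positivity
  congr 1
  field_simp
  ring

lemma mul_logb_one_add_sigmaSq_le {γ : ℝ} (hγ : γ ∈ Set.Ioc (0 : ℝ) 1) :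
    γ * logb 2 (1 + sigmaSq γ) ≤ 1.6081 := by
  obtain ⟨h0, h1⟩ := hγ
  rcases h1.eq_or_lt with rfl | h1
  · norm_num [sigmaSq, binH]
  · have h := log_one_add_exp_logNoise_le (u := (1 - γ) / γ) (div_pos (by linarith) h0)
    rw [← sigmaSq_eq_exp_logNoise h0 h1, show 1 + (1 - γ) / γ = 1 / γ by field_simp; ring,
      mul_one_div, le_div_iff₀ h0] at h
    rw [logb, ← mul_div_assoc, div_le_iff₀ (log_pos one_lt_two)]
    linarith

lemma gap_terms_eq {γ : ℝ} (hγ : 0 < γ) :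
    binH γ + (1 - γ) + γ * logb 2 (1 + 1 / sigmaSq γ) = γ * logb 2 (1 + sigmaSq γ) := by
  have hs : 0 < sigmaSq γ := rpow_pos_of_pos two_pos _
  have hlog : γ * logb 2 (sigmaSq γ) = binH γ + (1 - γ) := by
    rw [sigmaSq, logb_rpow two_pos (by norm_num)]
    field_simp
  rw [← hlog, ← mul_add, ← logb_mul hs.ne' (by positivity)]
  congr 2
  field_simp
  ring

/-- NNC deterministic-switch gap: with the equalizing quantization noise,
the max of the two gap terms equals γ log₂(1+σ²(γ)) and is at most 1.6081;
with σ² = 1 the gap is at most 2. -/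
theorem nnc_det_switch_gap :
    (∀ γ ∈ Set.Ioc (0:ℝ) 1,
      max (binH γ + (1 - γ) + γ * Real.logb 2 (1 + 1 / sigmaSq γ))
          (γ * Real.logb 2 (1 + sigmaSq γ))
        = γ * Real.logb 2 (1 + sigmaSq γ) ∧
      γ * Real.logb 2 (1 + sigmaSq γ) ≤ 1.6081) ∧
    (∀ γ ∈ Set.Ioc (0:ℝ) 1,
      max (binH γ + (1 - γ) + γ * Real.logb 2 (1 + 1 / (1:ℝ)))
          (γ * Real.logb 2 (1 + (1:ℝ))) ≤ 2) := by
  refine ⟨fun γ hγ => ⟨?_, mul_logb_one_add_sigmaSq_le hγ⟩, fun γ hγ => ?_⟩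
  · rw [gap_terms_eq hγ.1, max_self]
  · have hH : binH γ ≤ 1 := by
      rw [binH_eq, div_le_one (log_pos one_lt_two)]
      exact binEntropy_le_log_two
    have h2 : logb 2 2 = 1 := logb_self_eq_one one_lt_two
    obtain ⟨h0, h1⟩ := hγ
    norm_num [h2]
    constructor <;> linarith
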